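/- Assume (H1)–(H3) and set C₀ := sup_{x,y,t} |G(x,y,t,0,0)|. There exists a constant K, depending only on n, C₀, C₁, C₂ and l, such that for every α > 0 and every continuous, space-time periodic viscosity solution w^α of w^α_t + G(x,y,t,D_x w^α, D_y w^α) + α w^α = 0 on ℝⁿ×ℝ×ℝ one has max_{ℝⁿ×ℝ×ℝ} w^α − min_{ℝⁿ×ℝ×ℝ} w^α ≤ K. -/

import Mathlib

open MeasureTheory Topology Filter
open scoped RealInnerProductSpace

noncomputable section

/-- Euclidean space ℝⁿ. -/
abbrev Euc (n : ℕ) := EuclideanSpace ℝ (Fin n)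

/-- Hamiltonians G = G(x, y, t, p_x, p_y). -/
abbrev Ham (n : ℕ) := Euc n → ℝ → ℝ → Euc n → ℝ → ℝ

/-- The space of points (x, y, t) ∈ ℝⁿ×ℝ×ℝ. -/
abbrev Dom (n : ℕ) := Euc n × ℝ × ℝ

/-- The space of points ξ = (x, y, t, p_x, p_y). -/
abbrev Xi (n : ℕ) := Euc n × ℝ × ℝ × Euc n × ℝ

/-- The space of points (x, t) ∈ ℝⁿ×ℝ. -/
abbrev Dom2 (n : ℕ) := Euc n × ℝ

/-- The integer vector k viewed as a point of ℝⁿ. -/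
def intVec {n : ℕ} (k : Fin n → ℤ) : Euc n := WithLp.toLp 2 (fun i => (k i : ℝ))

/-- ∂φ/∂t for φ = φ(x,y,t). -/
def pdT {n : ℕ} (φ : Dom n → ℝ) (z : Dom n) : ℝ := fderiv ℝ φ z (0, 0, 1)

/-- ∂φ/∂y for φ = φ(x,y,t). -/
def pdY {n : ℕ} (φ : Dom n → ℝ) (z : Dom n) : ℝ := fderiv ℝ φ z (0, 1, 0)

/-- D_x φ for φ = φ(x,y,t). -/
def pdX {n : ℕ} (φ : Dom n → ℝ) (z : Dom n) : Euc n :=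
  WithLp.toLp 2 (fun i => fderiv ℝ φ z (EuclideanSpace.single i 1, 0, 0))

/-- ∂φ/∂t for φ = φ(x,t). -/
def pdT2 {n : ℕ} (φ : Dom2 n → ℝ) (z : Dom2 n) : ℝ := fderiv ℝ φ z (0, 1)

/-- D_x φ for φ = φ(x,t). -/
def pdX2 {n : ℕ} (φ : Dom2 n → ℝ) (z : Dom2 n) : Euc n :=
  WithLp.toLp 2 (fun i => fderiv ℝ φ z (EuclideanSpace.single i 1, 0))

/-- Viscosity subsolution of `w_t + G(x,y,t,D_x w,D_y w) + α w = λ` on ℝⁿ×ℝ×ℝ. -/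
def ViscSub {n : ℕ} (G : Ham n) (α lam : ℝ) (u : Dom n → ℝ) : Prop :=
  UpperSemicontinuous u ∧
  ∀ φ : Dom n → ℝ, ContDiff ℝ 1 φ → ∀ z : Dom n,
    IsLocalMax (fun w => u w - φ w) z →
    pdT φ z + G z.1 z.2.1 z.2.2 (pdX φ z) (pdY φ z) + α * u z ≤ lam

/-- Viscosity supersolution of `w_t + G(x,y,t,D_x w,D_y w) + α w = λ` on ℝⁿ×ℝ×ℝ. -/
def ViscSuper {n : ℕ} (G : Ham n) (α lam : ℝ) (u : Dom n → ℝ) : Prop :=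
  LowerSemicontinuous u ∧
  ∀ φ : Dom n → ℝ, ContDiff ℝ 1 φ → ∀ z : Dom n,
    IsLocalMin (fun w => u w - φ w) z →
    lam ≤ pdT φ z + G z.1 z.2.1 z.2.2 (pdX φ z) (pdY φ z) + α * u z

/-- Viscosity solution of `w_t + G(x,y,t,D_x w,D_y w) + α w = λ` on ℝⁿ×ℝ×ℝ. -/
def ViscSol {n : ℕ} (G : Ham n) (α lam : ℝ) (u : Dom n → ℝ) : Prop :=
  Continuous u ∧ ViscSub G α lam u ∧ ViscSuper G α lam u

/-- ℤⁿ-periodicity in x, 1-periodicity in y and t. -/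
def STPeriodic {n : ℕ} (u : Dom n → ℝ) : Prop :=
  (∀ (k : Fin n → ℤ) (x : Euc n) (y t : ℝ), u (x + intVec k, y, t) = u (x, y, t)) ∧
  (∀ x y t, u (x, y + 1, t) = u (x, y, t)) ∧
  (∀ x y t, u (x, y, t + 1) = u (x, y, t))

/-- Boundedness of a function on ℝⁿ×ℝ×ℝ. -/
def Bdd {n : ℕ} (u : Dom n → ℝ) : Prop := ∃ M, ∀ z, |u z| ≤ M

/-- (H1) : continuity and periodicity of the Hamiltonian. -/
def HypH1 {n : ℕ} (G : Ham n) : Prop :=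
  Continuous (fun ξ : Xi n => G ξ.1 ξ.2.1 ξ.2.2.1 ξ.2.2.2.1 ξ.2.2.2.2) ∧
  (∀ (k : Fin n → ℤ) x y t px py, G (x + intVec k) y t px py = G x y t px py) ∧
  (∀ x y t px py, G x (y + 1) t px py = G x y t px py) ∧
  (∀ x y t px py, G x y (t + 1) px py = G x y t px py)

/-- (H2) : coercivity in p_x at p_y = 0, with constants C₁, C₂ > 0. -/
def HypH2 {n : ℕ} (G : Ham n) (C₁ C₂ : ℝ) : Prop :=
  0 < C₁ ∧ 0 < C₂ ∧ ∀ x y t px, C₁ * ‖px‖ - C₂ ≤ G x y t px 0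

/-- (H2') : coercivity in p_x, locally uniformly in p_y. -/
def HypH2' {n : ℕ} (F : Ham n) : Prop :=
  ∀ R : ℝ, 0 < R → ∃ C₁ C₂ : ℝ, 0 < C₁ ∧ 0 < C₂ ∧
    ∀ x y t px py, |py| ≤ R → C₁ * ‖px‖ - C₂ ≤ F x y t px py

/-- (H3) : local Lipschitz continuity in (y,t,p_y) and a.e. bounds on the
partial derivatives ∂_y G, ∂_t G, ∂_{p_y} G. -/
def HypH3 {n : ℕ} (G : Ham n) (l C₃ C₄ C₅ : ℝ) : Prop :=
  0 ≤ C₃ ∧ 0 ≤ C₄ ∧ 0 ≤ C₅ ∧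
  (∀ (x px : Euc n), LocallyLipschitz (fun q : ℝ × ℝ × ℝ => G x q.1 q.2.1 px q.2.2)) ∧
  (∀ᵐ ξ ∂(volume : Measure (Xi n)),
    |deriv (fun y => G ξ.1 y ξ.2.2.1 ξ.2.2.2.1 ξ.2.2.2.2) ξ.2.1| ≤ C₃ * |ξ.2.2.2.2 + l| ∧
    |deriv (fun t => G ξ.1 ξ.2.1 t ξ.2.2.2.1 ξ.2.2.2.2) ξ.2.2.1| ≤
      C₄ * (1 + |ξ.2.2.2.2| + |G ξ.1 ξ.2.1 ξ.2.2.1 ξ.2.2.2.1 ξ.2.2.2.2|) ∧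
    |deriv (fun py => G ξ.1 ξ.2.1 ξ.2.2.1 ξ.2.2.2.1 py) ξ.2.2.2.2| ≤ C₅)

/-- λ is an ergodic constant : bounded usc subsolution and bounded lsc
supersolution of `w_t + G = λ` exist. -/
def ErgodicConst {n : ℕ} (G : Ham n) (lam : ℝ) : Prop :=
  (∃ u, Bdd u ∧ ViscSub G 0 lam u) ∧ (∃ v, Bdd v ∧ ViscSuper G 0 lam v)

/-- λ solves the cell problem at (p_x,p_y) : the equation
`v_t + F(x,y,t,p_x + D_x v, p_y + D_y v) = λ` has a bounded space-time periodic
usc subsolution and a bounded space-time periodic lsc supersolution. -/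
def CellOk {n : ℕ} (F : Ham n) (px : Euc n) (py lam : ℝ) : Prop :=
  (∃ u, Bdd u ∧ STPeriodic u ∧
    ViscSub (fun x y t qx qy => F x y t (px + qx) (py + qy)) 0 lam u) ∧
  (∃ v, Bdd v ∧ STPeriodic v ∧
    ViscSuper (fun x y t qx qy => F x y t (px + qx) (py + qy)) 0 lam v)

/-- Viscosity subsolution of `w_t + G(x,y,t,D_x w,D_y w) = 0` on ℝⁿ×ℝ×(0,∞). -/
def ViscSubPos {n : ℕ} (G : Ham n) (u : Dom n → ℝ) : Prop :=
  ∀ φ : Dom n → ℝ, ContDiff ℝ 1 φ → ∀ z : Dom n, 0 < z.2.2 →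
    IsLocalMax (fun w => u w - φ w) z →
    pdT φ z + G z.1 z.2.1 z.2.2 (pdX φ z) (pdY φ z) ≤ 0

/-- Viscosity supersolution of `w_t + G(x,y,t,D_x w,D_y w) = 0` on ℝⁿ×ℝ×(0,∞). -/
def ViscSuperPos {n : ℕ} (G : Ham n) (u : Dom n → ℝ) : Prop :=
  ∀ φ : Dom n → ℝ, ContDiff ℝ 1 φ → ∀ z : Dom n, 0 < z.2.2 →
    IsLocalMin (fun w => u w - φ w) z →
    0 ≤ pdT φ z + G z.1 z.2.1 z.2.2 (pdX φ z) (pdY φ z)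

/-- Bounded uniformly continuous (on every slab ℝⁿ×ℝ×[0,T]) viscosity solution of the
initial value problem `v_t + G(x,y,t,D_x v,D_y v) = 0` on ℝⁿ×ℝ×(0,∞), `v(x,y,0) = v₀(x,y)`. -/
def IVPSol {n : ℕ} (G : Ham n) (v₀ : Dom2 n → ℝ) (v : Dom n → ℝ) : Prop :=
  ContinuousOn v {z : Dom n | 0 ≤ z.2.2} ∧
  (∀ x y, v (x, y, 0) = v₀ (x, y)) ∧
  ViscSubPos G v ∧ ViscSuperPos G v ∧
  (∀ T : ℝ, 0 < T →
    (∃ M, ∀ z : Dom n, 0 ≤ z.2.2 → z.2.2 ≤ T → |v z| ≤ M) ∧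
    UniformContinuousOn v {z : Dom n | 0 ≤ z.2.2 ∧ z.2.2 ≤ T})

/-- Viscosity subsolution of the eikonal-type inequality `w_t + c|D_x w| - C ≤ 0` on ℝⁿ×ℝ. -/
def ViscSubEik {n : ℕ} (c C : ℝ) (u : Dom2 n → ℝ) : Prop :=
  UpperSemicontinuous u ∧
  ∀ φ : Dom2 n → ℝ, ContDiff ℝ 1 φ → ∀ z : Dom2 n,
    IsLocalMax (fun w => u w - φ w) z →
    pdT2 φ z + c * ‖pdX2 φ z‖ - C ≤ 0


/-! ### Part 1: consequences of (H3) -/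

instance haarXi (n : ℕ) : (volume : Measure (Xi n)).IsAddHaarMeasure := by
  have h1 : (volume : Measure (Euc n × ℝ)).IsAddHaarMeasure :=
    Measure.prod.instIsAddHaarMeasure _ _
  have h2 : (volume : Measure (ℝ × Euc n × ℝ)).IsAddHaarMeasure :=
    Measure.prod.instIsAddHaarMeasure _ _
  have h3 : (volume : Measure (ℝ × ℝ × Euc n × ℝ)).IsAddHaarMeasure :=
    Measure.prod.instIsAddHaarMeasure _ _
  exact Measure.prod.instIsAddHaarMeasure _ _

lemma line_ae {n : ℕ} {p : Xi n → Prop} (h : ∀ᵐ ξ ∂(volume : Measure (Xi n)), p ξ) (v : Xi n) :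
    ∀ᵐ ξ ∂(volume : Measure (Xi n)), ∀ᵐ s ∂(volume : Measure ℝ), p (ξ + s • v) := by
  obtain ⟨S, hS, hm, h0⟩ := exists_measurable_superset_of_null (ae_iff.1 h)
  have h1 : ∀ᵐ ξ ∂(volume : Measure (Xi n)), ξ ∈ Sᶜ := by
    rw [ae_iff]; simpa using h0
  have h2 := (ae_ae_add_linearMap_mem_iff (𝕜 := ℝ) (LinearMap.toSpanSingleton ℝ (Xi n) v)
    (volume : Measure ℝ) (volume : Measure (Xi n)) hm.compl).2 h1
  filter_upwards [h2] with ξ h3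
  filter_upwards [h3] with s h4
  by_contra h5
  exact h4 (hS h5)

lemma all_of_ae {n : ℕ} {p : Xi n → Prop} (h : ∀ᵐ ξ ∂(volume : Measure (Xi n)), p ξ)
    (hc : IsClosed {ξ | p ξ}) (ξ : Xi n) : p ξ := by
  have := Measure.dense_of_ae h
  have h2 : closure {ξ | p ξ} = Set.univ := this.closure_eq
  rw [hc.closure_eq] at h2
  have : ξ ∈ {ξ | p ξ} := by rw [h2]; trivial
  exact this

lemma lip_of_ae {f : ℝ → ℝ} (hf : LocallyLipschitz f) {a b C : ℝ}
    (h : ∀ᵐ x : ℝ, x ∈ Set.uIoc a b → |deriv f x| ≤ C) : |f b - f a| ≤ C * |b - a| := by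
  obtain ⟨K, hK⟩ := (hf.locallyLipschitzOn (s := Set.uIcc a b)).exists_lipschitzOnWith_of_compact
    isCompact_uIcc
  rw [← hK.absolutelyContinuousOnInterval.integral_deriv_eq_sub]
  simpa only [Real.norm_eq_abs] using
    intervalIntegral.norm_integral_le_of_norm_le_const_ae (f := deriv f) h

lemma gron_of_ae {f : ℝ → ℝ} (hf : LocallyLipschitz f) {a b C P : ℝ} (hC : 0 ≤ C) (hP : 0 ≤ P)
    (h : ∀ᵐ x : ℝ, |deriv f x| ≤ C * (P + |f x|)) (hs : C * |b - a| ≤ 1 / 2) :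
    |f b - f a| ≤ 2 * C * |b - a| * (P + |f a|) := by
  obtain ⟨m, hm, hmax⟩ := (isCompact_uIcc (a := a) (b := b)).exists_isMaxOn ⟨a, Set.left_mem_uIcc⟩
    hf.continuous.abs.continuousOn
  have hmax' : ∀ x ∈ Set.uIcc a b, |f x| ≤ |f m| := fun x hx => hmax hx
  have key : ∀ c ∈ Set.uIcc a b, |f c - f a| ≤ C * (P + |f m|) * |b - a| := by
    intro c hc
    have h1 : |f c - f a| ≤ C * (P + |f m|) * |c - a| := by
      apply lip_of_ae hf
      filter_upwards [h] with x hx hxI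
      refine hx.trans ?_
      have : |f x| ≤ |f m| := hmax' x (Set.uIcc_subset_uIcc_left hc (Set.uIoc_subset_uIcc hxI))
      gcongr
    refine h1.trans ?_
    have : |c - a| ≤ |b - a| := Set.abs_sub_left_of_mem_uIcc hc
    gcongr
  have k1 := key m hm
  have k2 := key b Set.right_mem_uIcc
  have k3 : |f m| ≤ |f a| + |f m - f a| := by
    have := abs_add_le (f a) (f m - f a); simpa using this
  have k4 : (P + |f m|) ≤ 2 * (P + |f a|) := by
    have : C * (P + |f m|) * |b - a| ≤ 1 / 2 * (P + |f m|) := by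
      have : C * (P + |f m|) * |b - a| = (C * |b - a|) * (P + |f m|) := by ring
      rw [this]; gcongr
    linarith
  calc _ ≤ _ := k2
    _ ≤ C * (2 * (P + |f a|)) * |b - a| := by gcongr
    _ = _ := by ring

section
variable {n : ℕ} {G : Ham n} {l C₃ C₄ C₅ : ℝ}

lemma reg_y (h1 : HypH1 G) (h3 : HypH3 G l C₃ C₄ C₅) (x y t px py s) :
    |G x (y + s) t px py - G x y t px py| ≤ C₃ * |py + l| * |s| := by
  obtain ⟨hc, -⟩ := h1
  obtain ⟨c3, c4, c5, hL, hae⟩ := h3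
  have := line_ae hae (0, 1, 0, 0, 0)
  refine all_of_ae (p := fun ξ : Xi n => ∀ s : ℝ, |G ξ.1 (ξ.2.1 + s) ξ.2.2.1 ξ.2.2.2.1 ξ.2.2.2.2 -
    G ξ.1 ξ.2.1 ξ.2.2.1 ξ.2.2.2.1 ξ.2.2.2.2| ≤ C₃ * |ξ.2.2.2.2 + l| * |s|) ?_ ?_ (x, y, t, px, py) s
  · filter_upwards [this] with ξ hξ s
    have hf : LocallyLipschitz (fun s => G ξ.1 (ξ.2.1 + s) ξ.2.2.1 ξ.2.2.2.1 ξ.2.2.2.2) := by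
      have h2 : LocallyLipschitz (fun s : ℝ => ((ξ.2.1 + s, ξ.2.2.1, ξ.2.2.2.2) : ℝ × ℝ × ℝ)) :=
        (by fun_prop : ContDiff ℝ 1 (fun s : ℝ => ((ξ.2.1 + s, ξ.2.2.1, ξ.2.2.2.2) : ℝ × ℝ × ℝ))).locallyLipschitz
      exact (hL ξ.1 ξ.2.2.2.1).comp h2
    have := lip_of_ae hf (a := 0) (b := s) (C := C₃ * |ξ.2.2.2.2 + l|) ?_
    · simpa using this
    filter_upwards [hξ] with r hr _
    have h := hr.1
    simp only [Prod.fst_add, Prod.snd_add, Prod.smul_fst, Prod.smul_snd, smul_zero, add_zero,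
      smul_eq_mul, mul_one, mul_zero] at h
    rw [deriv_comp_const_add (f := fun y => G ξ.1 y ξ.2.2.1 ξ.2.2.2.1 ξ.2.2.2.2)]
    exact h
  · simp only [Set.ofPred_forall]
    refine isClosed_iInter fun s => isClosed_le ?_ ?_
    · refine Continuous.abs (Continuous.sub ?_ ?_)
      · exact hc.comp (f := fun ξ : Xi n => (ξ.1, ξ.2.1 + s, ξ.2.2.1, ξ.2.2.2.1, ξ.2.2.2.2)) (by fun_prop)
      · exact hc
    · fun_prop

lemma reg_p (h1 : HypH1 G) (h3 : HypH3 G l C₃ C₄ C₅) (x y t px py s) :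
    |G x y t px (py + s) - G x y t px py| ≤ C₅ * |s| := by
  obtain ⟨hc, -⟩ := h1
  obtain ⟨c3, c4, c5, hL, hae⟩ := h3
  have := line_ae hae (0, 0, 0, 0, 1)
  refine all_of_ae (p := fun ξ : Xi n => ∀ s : ℝ, |G ξ.1 ξ.2.1 ξ.2.2.1 ξ.2.2.2.1 (ξ.2.2.2.2 + s) -
    G ξ.1 ξ.2.1 ξ.2.2.1 ξ.2.2.2.1 ξ.2.2.2.2| ≤ C₅ * |s|) ?_ ?_ (x, y, t, px, py) s
  · filter_upwards [this] with ξ hξ s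
    have hf : LocallyLipschitz (fun s => G ξ.1 ξ.2.1 ξ.2.2.1 ξ.2.2.2.1 (ξ.2.2.2.2 + s)) := by
      have h2 : LocallyLipschitz (fun s : ℝ => ((ξ.2.1, ξ.2.2.1, ξ.2.2.2.2 + s) : ℝ × ℝ × ℝ)) :=
        (by fun_prop : ContDiff ℝ 1 (fun s : ℝ => ((ξ.2.1, ξ.2.2.1, ξ.2.2.2.2 + s) : ℝ × ℝ × ℝ))).locallyLipschitz
      exact (hL ξ.1 ξ.2.2.2.1).comp h2
    have := lip_of_ae hf (a := 0) (b := s) (C := C₅) ?_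
    · simpa using this
    filter_upwards [hξ] with r hr _
    have h := hr.2.2
    simp only [Prod.fst_add, Prod.snd_add, Prod.smul_fst, Prod.smul_snd, smul_zero, add_zero,
      smul_eq_mul, mul_one, mul_zero] at h
    rw [deriv_comp_const_add (f := fun y => G ξ.1 ξ.2.1 ξ.2.2.1 ξ.2.2.2.1 y)]
    exact h
  · simp only [Set.ofPred_forall]
    refine isClosed_iInter fun s => isClosed_le ?_ ?_
    · refine Continuous.abs (Continuous.sub ?_ ?_)
      · exact hc.comp (f := fun ξ : Xi n => (ξ.1, ξ.2.1, ξ.2.2.1, ξ.2.2.2.1, ξ.2.2.2.2 + s)) (by fun_prop)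
      · exact hc
    · fun_prop

lemma reg_t (h1 : HypH1 G) (h3 : HypH3 G l C₃ C₄ C₅) (x y t px py s) (hs : C₄ * |s| ≤ 1 / 2) :
    |G x y (t + s) px py - G x y t px py| ≤ 2 * C₄ * |s| * (1 + |py| + |G x y t px py|) := by
  obtain ⟨hc, -⟩ := h1
  obtain ⟨c3, c4, c5, hL, hae⟩ := h3
  have := line_ae hae (0, 0, 1, 0, 0)
  refine all_of_ae (p := fun ξ : Xi n => |G ξ.1 ξ.2.1 (ξ.2.2.1 + s) ξ.2.2.2.1 ξ.2.2.2.2 -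
    G ξ.1 ξ.2.1 ξ.2.2.1 ξ.2.2.2.1 ξ.2.2.2.2| ≤ 2 * C₄ * |s| * (1 + |ξ.2.2.2.2| +
      |G ξ.1 ξ.2.1 ξ.2.2.1 ξ.2.2.2.1 ξ.2.2.2.2|)) ?_ ?_ (x, y, t, px, py)
  · filter_upwards [this] with ξ hξ
    have hf : LocallyLipschitz (fun s => G ξ.1 ξ.2.1 (ξ.2.2.1 + s) ξ.2.2.2.1 ξ.2.2.2.2) := by
      have h2 : LocallyLipschitz (fun s : ℝ => ((ξ.2.1, ξ.2.2.1 + s, ξ.2.2.2.2) : ℝ × ℝ × ℝ)) :=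
        (by fun_prop : ContDiff ℝ 1 (fun s : ℝ => ((ξ.2.1, ξ.2.2.1 + s, ξ.2.2.2.2) : ℝ × ℝ × ℝ))).locallyLipschitz
      exact (hL ξ.1 ξ.2.2.2.1).comp h2
    have := gron_of_ae hf (a := 0) (b := s) (C := C₄) (P := 1 + |ξ.2.2.2.2|) c4 (by positivity) ?_
      (by simpa using hs)
    · simpa using this
    filter_upwards [hξ] with r hr
    have h := hr.2.1
    simp only [Prod.fst_add, Prod.snd_add, Prod.smul_fst, Prod.smul_snd, smul_zero, add_zero,
      smul_eq_mul, mul_one, mul_zero] at h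
    rw [deriv_comp_const_add (f := fun t => G ξ.1 ξ.2.1 t ξ.2.2.2.1 ξ.2.2.2.2)]
    exact h
  · refine isClosed_le ?_ ?_
    · refine Continuous.abs (Continuous.sub ?_ ?_)
      · exact hc.comp (f := fun ξ : Xi n => (ξ.1, ξ.2.1, ξ.2.2.1 + s, ξ.2.2.2.1, ξ.2.2.2.2)) (by fun_prop)
      · exact hc
    · exact continuous_const.mul ((by fun_prop : Continuous fun ξ : Xi n => 1 + |ξ.2.2.2.2|).add hc.abs)

end

/-! ### Part 2: periodic functions -/

lemma per_shift {n : ℕ} {u : Dom n → ℝ} (h : STPeriodic u) (k : Fin n → ℤ) (a b : ℤ) (x y t) :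
    u (x + intVec k, y + a, t + b) = u (x, y, t) := by
  obtain ⟨h1, h2, h3⟩ := h
  rw [h1]
  have e2 : Function.Periodic (fun y => u (x, y, t + b)) 1 := fun y => h2 x y _
  have e3 : Function.Periodic (fun t => u (x, y, t)) 1 := fun t => h3 x y t
  have := e2.int_mul a y
  have h4 := e3.int_mul b t
  simp only [mul_one] at this h4
  rw [this, h4]

lemma per_red {n : ℕ} (x : Euc n) (y t : ℝ) : ∃ (k : Fin n → ℤ) (a b : ℤ),
    ‖x + intVec k‖ ≤ n + 1 ∧ |y + a| ≤ 1 ∧ |t + b| ≤ 1 := by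
  have hfr : ∀ r : ℝ, |r + ((-⌊r⌋ : ℤ) : ℝ)| ≤ 1 := by
    intro r
    have h1 := Int.floor_le r
    have h2 := Int.lt_floor_add_one r
    push_cast
    rw [abs_le]; constructor <;> linarith
  refine ⟨fun i => -⌊x i⌋, -⌊y⌋, -⌊t⌋, ?_, hfr y, hfr t⟩
  have h2 : ∀ i, ‖(x + intVec fun i => -⌊x i⌋) i‖ ≤ 1 := by
    intro i
    simpa [intVec] using hfr (x i)
  rw [EuclideanSpace.norm_eq]
  have h3 : ∑ i, ‖(x + intVec fun i => -⌊x i⌋) i‖ ^ 2 ≤ n := by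
    calc _ ≤ ∑ i : Fin n, (1 : ℝ) := by
          apply Finset.sum_le_sum
          intro i _
          have := h2 i
          have h0 := norm_nonneg ((x + intVec fun i => -⌊x i⌋) i)
          nlinarith
      _ = n := by simp
  rw [Real.sqrt_le_left (by positivity)]
  have : (0 : ℝ) ≤ n := by positivity
  nlinarith

lemma per_red' {n : ℕ} (x : Euc n) (y t : ℝ) : ∃ (k : Fin n → ℤ) (a b : ℤ),
    ‖((x + intVec k, y + a, t + b) : Dom n)‖ ≤ n + 1 := by
  obtain ⟨k, a, b, h1, h2, h3⟩ := per_red x y t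
  refine ⟨k, a, b, ?_⟩
  have : (0 : ℝ) ≤ n := by positivity
  simp only [Prod.norm_def, Real.norm_eq_abs, sup_le_iff]
  exact ⟨h1, by linarith, by linarith⟩

lemma exists_max {X : Type*} [TopologicalSpace X] {f : X → ℝ} {S K : Set X} (hf : Continuous f)
    (hK : IsCompact K) (hKS : K ⊆ S) (hne : K.Nonempty)
    (h : ∀ x ∈ S, ∃ y ∈ K, f x ≤ f y) : ∃ m ∈ S, ∀ x ∈ S, f x ≤ f m := by
  obtain ⟨m, hm, hmax⟩ := hK.exists_isMaxOn hne hf.continuousOn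
  refine ⟨m, hKS hm, fun x hx => ?_⟩
  obtain ⟨y, hy, hxy⟩ := h x hx
  exact hxy.trans (hmax hy)

lemma per_max {n : ℕ} {u : Dom n → ℝ} (h : STPeriodic u) (hc : Continuous u) :
    ∃ m, ∀ z, u z ≤ u m := by
  obtain ⟨m, -, hm⟩ := exists_max (S := Set.univ) (K := Metric.closedBall (0 : Dom n) (n + 1)) hc
    (isCompact_closedBall _ _) (Set.subset_univ _) ⟨0, by simp; positivity⟩ (fun z _ => by
      obtain ⟨k, a, b, hk⟩ := per_red' z.1 z.2.1 z.2.2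
      exact ⟨_, by simpa using hk, (per_shift h k a b _ _ _).ge⟩)
  exact ⟨m, fun z => hm z trivial⟩

lemma per_bdd {n : ℕ} {u : Dom n → ℝ} (h : STPeriodic u) (hc : Continuous u) :
    ∃ M, 0 ≤ M ∧ ∀ z, |u z| ≤ M := by
  obtain ⟨m, hm⟩ := per_max (u := fun z => |u z|)
    ⟨fun k x y t => by simp [h.1], fun x y t => by simp [h.2.1], fun x y t => by simp [h.2.2]⟩ hc.abs
  exact ⟨_, abs_nonneg _, hm⟩

lemma per_uc {n : ℕ} {u : Dom n → ℝ} (h : STPeriodic u) (hc : Continuous u) {ε : ℝ} (hε : 0 < ε) :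
    ∃ r > 0, ∀ x y t x' y' t', ‖x - x'‖ < r → |y - y'| < r → |t - t'| < r →
      |u (x, y, t) - u (x', y', t')| < ε := by
  have huc := (isCompact_closedBall (0 : Dom n) (n + 2)).uniformContinuousOn_of_continuous
    hc.continuousOn
  rw [Metric.uniformContinuousOn_iff] at huc
  obtain ⟨r, hr, H⟩ := huc ε hε
  refine ⟨min r 1, by positivity, fun x y t x' y' t' hx hy ht => ?_⟩
  obtain ⟨k, a, b, hk⟩ := per_red' x y t
  have hd : dist ((x + intVec k, y + a, t + b) : Dom n) (x' + intVec k, y' + a, t' + b) < min r 1 := by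
    simp only [Prod.dist_eq, dist_add_right, sup_lt_iff]
    exact ⟨by rwa [dist_eq_norm], by rwa [Real.dist_eq], by rwa [Real.dist_eq]⟩
  have := H (x + intVec k, y + a, t + b) (by simp only [Metric.mem_closedBall, dist_zero_right]; linarith)
    (x' + intVec k, y' + a, t' + b) (by
      rw [Metric.mem_closedBall]
      rw [← dist_zero_right] at hk
      have h2 := dist_triangle_left ((x' + intVec k, y' + a, t' + b) : Dom n) 0 (x + intVec k, y + a, t + b)
      have h3 := min_le_right r 1
      linarith) (hd.trans_le (min_le_left _ _))
  rwa [per_shift h, per_shift h, Real.dist_eq] at this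

lemma G_uc {n : ℕ} {G : Ham n} (h1 : HypH1 G) (R : ℝ) {ε : ℝ} (hε : 0 < ε) :
    ∃ r > 0, ∀ x x' y t px py, ‖x - x'‖ < r → ‖px‖ ≤ R → |py| ≤ R →
      |G x y t px py - G x' y t px py| < ε := by
  obtain ⟨hc, p1, p2, p3⟩ := h1
  have hper : ∀ px py, STPeriodic (fun z : Dom n => G z.1 z.2.1 z.2.2 px py) := fun px py =>
    ⟨fun k x y t => p1 k x y t px py, fun x y t => p2 x y t px py, fun x y t => p3 x y t px py⟩
  have huc := (isCompact_closedBall (0 : Xi n) (n + 2 + |R|)).uniformContinuousOn_of_continuous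
    hc.continuousOn
  rw [Metric.uniformContinuousOn_iff] at huc
  obtain ⟨r, hr, H⟩ := huc ε hε
  refine ⟨min r 1, by positivity, fun x x' y t px py hx hpx hpy => ?_⟩
  obtain ⟨k, a, b, hx1, hy1, ht1⟩ := per_red x y t
  have hR := le_abs_self R
  have hR0 := abs_nonneg R
  have hn : (0 : ℝ) ≤ n := by positivity
  have h3 := min_le_right r 1
  have hx2 : ‖x' + intVec k‖ ≤ n + 2 := by
    have := norm_sub_le (x + intVec k) (x - x')
    have e : x + intVec k - (x - x') = x' + intVec k := by abel
    rw [e] at this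
    linarith
  have := H (x + intVec k, y + a, t + b, px, py) (by
      simp only [Metric.mem_closedBall, dist_zero_right, Prod.norm_def, Real.norm_eq_abs, sup_le_iff]
      refine ⟨?_, ?_, ?_, ?_, ?_⟩ <;> linarith)
    (x' + intVec k, y + a, t + b, px, py) (by
      simp only [Metric.mem_closedBall, dist_zero_right, Prod.norm_def, Real.norm_eq_abs, sup_le_iff]
      refine ⟨?_, ?_, ?_, ?_, ?_⟩ <;> linarith) (by
      simp only [Prod.dist_eq, dist_add_right, dist_self, sup_lt_iff]
      refine ⟨?_, by simpa using hr⟩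
      rw [dist_eq_norm]; exact hx.trans_le (min_le_left _ _))
  have e1 := per_shift (hper px py) k a b x y t
  have e2 := per_shift (hper px py) k a b x' y t
  simp only at e1 e2 this
  rwa [e1, e2, Real.dist_eq] at this

/-! ### Part 3: test functions -/

/-- The squared positive part. -/
def qq (s : ℝ) : ℝ := (max s 0) ^ 2

lemma qq_deriv (s : ℝ) : HasDerivAt qq (2 * max s 0) s := by
  rcases lt_trichotomy s 0 with h | h | h
  · rw [max_eq_right h.le, mul_zero]
    refine (hasDerivAt_const s (0 : ℝ)).congr_of_eventuallyEq ?_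
    filter_upwards [gt_mem_nhds h] with r hr
    simp [qq, max_eq_right hr.le]
  · subst h
    simp only [max_self, mul_zero]
    rw [hasDerivAt_iff_isLittleO]
    have : (fun x : ℝ => qq x - qq 0 - (x - 0) • (0 : ℝ)) =O[𝓝 0] fun x => x ^ 2 := by
      refine Asymptotics.IsBigO.of_bound 1 (Eventually.of_forall fun x => ?_)
      simp only [qq, max_self, smul_eq_mul, mul_zero, sub_zero, Real.norm_eq_abs, abs_pow, sq_abs, one_mul]
      rcases le_total x 0 with h | h
      · simp [max_eq_right h]; positivity
      · simp [max_eq_left h]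
    refine this.trans_isLittleO ?_
    simp only [sub_zero]
    exact Asymptotics.isLittleO_pow_id one_lt_two
  · rw [max_eq_left h.le]
    have : HasDerivAt (fun s : ℝ => s ^ 2) (2 * s) s := by simpa using hasDerivAt_pow 2 s
    refine this.congr_of_eventuallyEq ?_
    filter_upwards [lt_mem_nhds h] with r hr
    simp [qq, max_eq_left hr.le]

lemma qq_comp {g : ℝ → ℝ} {g' x : ℝ} (hg : HasDerivAt g g' x) :
    HasDerivAt (fun r => qq (g r)) (2 * max (g x) 0 * g') x :=
  HasDerivAt.comp x (qq_deriv (g x)) hg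

lemma qq_contDiff : ContDiff ℝ 1 qq := by
  rw [contDiff_one_iff_deriv]
  refine ⟨fun s => (qq_deriv s).differentiableAt, ?_⟩
  have : deriv qq = fun s => 2 * max s 0 := funext fun s => (qq_deriv s).deriv
  rw [this]
  fun_prop

lemma qq_nonneg (s : ℝ) : 0 ≤ qq s := sq_nonneg _

lemma pd_of {n : ℕ} {H : ℝ × ℝ × ℝ → ℝ} (hH : ContDiff ℝ 1 H) (a x : Euc n) (y t : ℝ) {h1 h2 h3 : ℝ}
    (e1 : HasDerivAt (fun r => H (r, y, t)) h1 (‖x - a‖ ^ 2))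
    (e2 : HasDerivAt (fun r => H (‖x - a‖ ^ 2, r, t)) h2 y)
    (e3 : HasDerivAt (fun r => H (‖x - a‖ ^ 2, y, r)) h3 t) :
    ContDiff ℝ 1 (fun z : Dom n => H (‖z.1 - a‖ ^ 2, z.2.1, z.2.2)) ∧
    pdX (fun z : Dom n => H (‖z.1 - a‖ ^ 2, z.2.1, z.2.2)) (x, y, t) = (2 * h1) • (x - a) ∧
    pdY (fun z : Dom n => H (‖z.1 - a‖ ^ 2, z.2.1, z.2.2)) (x, y, t) = h2 ∧
    pdT (fun z : Dom n => H (‖z.1 - a‖ ^ 2, z.2.1, z.2.2)) (x, y, t) = h3 := by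
  have hin : ContDiff ℝ 1 (fun z : Dom n => ((‖z.1 - a‖ ^ 2, z.2.1, z.2.2) : ℝ × ℝ × ℝ)) := by
    refine ContDiff.prodMk ?_ (by fun_prop)
    exact ContDiff.norm_sq ℝ (by fun_prop)
  have hc : ContDiff ℝ 1 (fun z : Dom n => H (‖z.1 - a‖ ^ 2, z.2.1, z.2.2)) := hH.comp hin
  have hd : DifferentiableAt ℝ (fun z : Dom n => H (‖z.1 - a‖ ^ 2, z.2.1, z.2.2)) (x, y, t) :=
    hc.differentiable (by norm_num) _
  have key : ∀ (v : Dom n) (γ : ℝ → Dom n) (s d : ℝ), γ s = (x, y, t) → HasDerivAt γ v s →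
      HasDerivAt (fun r => H (‖(γ r).1 - a‖ ^ 2, (γ r).2.1, (γ r).2.2)) d s →
      fderiv ℝ (fun z : Dom n => H (‖z.1 - a‖ ^ 2, z.2.1, z.2.2)) (x, y, t) v = d := by
    intro v γ s d hs hγ hdd
    have h0 := hd.hasFDerivAt
    rw [← hs] at h0 ⊢
    have := h0.comp_hasDerivAt s hγ
    exact this.unique hdd
  refine ⟨hc, ?_, ?_, ?_⟩
  · ext i
    simp only [pdX, PiLp.smul_apply, smul_eq_mul]
    apply key _ (fun r => (x + r • EuclideanSpace.single i 1, y, t)) 0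
    · simp
    · refine HasDerivAt.prodMk ?_ (HasDerivAt.prodMk (hasDerivAt_const _ _) (hasDerivAt_const _ _))
      simpa using ((hasDerivAt_id (0 : ℝ)).smul_const (EuclideanSpace.single i (1 : ℝ))).const_add x
    · have hg : HasDerivAt (fun r : ℝ => ‖(x + r • EuclideanSpace.single i (1 : ℝ)) - a‖ ^ 2)
          (2 * (x - a) i) 0 := by
        have h1 : HasDerivAt (fun r : ℝ => (x + r • EuclideanSpace.single i (1 : ℝ)) - a)
            (EuclideanSpace.single i (1 : ℝ)) 0 := by
          simpa using (((hasDerivAt_id (0 : ℝ)).smul_const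
            (EuclideanSpace.single i (1 : ℝ))).const_add x).sub_const a
        have := h1.norm_sq
        simpa [EuclideanSpace.inner_single_right] using this
      have e1' : HasDerivAt (fun r => H (r, y, t)) h1
          ((fun r : ℝ => ‖(x + r • EuclideanSpace.single i (1 : ℝ)) - a‖ ^ 2) 0) := by
        simpa using e1
      have := e1'.comp 0 hg
      have e : 2 * h1 * (x - a) i = h1 * (2 * (x - a) i) := by ring
      rw [e]
      exact this
  · apply key _ (fun r => (x, r, t)) y _ rfl
    · exact HasDerivAt.prodMk (hasDerivAt_const _ _) (HasDerivAt.prodMk (hasDerivAt_id _) (hasDerivAt_const _ _))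
    · exact e2
  · apply key _ (fun r => (x, y, r)) t _ rfl
    · exact HasDerivAt.prodMk (hasDerivAt_const _ _) (HasDerivAt.prodMk (hasDerivAt_const _ _) (hasDerivAt_id _))
    · exact e3

/-! ### Part 4: the eikonal estimate -/

lemma eik {n : ℕ} {G : Ham n} {C₀ C₁ C₂ α : ℝ} (h2 : HypH2 G C₁ C₂) (hC₀ : 0 ≤ C₀)
    {w : Dom n → ℝ} (hp : STPeriodic w) (hc : Continuous w) (hsub : ViscSub G α 0 w)
    (hlow : ∀ z, -C₀ ≤ α * w z) {x₀ : Euc n} {t₀ S : ℝ} (hS : ∀ y, w (x₀, y, t₀) ≤ S)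
    {x₁ : Euc n} {y₁ t₁ : ℝ} (ht : t₀ ≤ t₁) (hx : ‖x₁ - x₀‖ ≤ C₁ * (t₁ - t₀)) :
    w (x₁, y₁, t₁) ≤ S + 1 + (C₂ + C₀ + 1) * (t₁ - t₀) := by
  obtain ⟨c1, c2, hG⟩ := h2
  obtain ⟨M, hM0, hM⟩ := per_bdd hp hc
  obtain ⟨r, hr, huc⟩ := per_uc hp hc one_pos
  set L := C₂ + C₀ + 1 with hL
  have hLpos : 0 < L := by positivity
  set ρ := r / 2 with hρ
  have hρ0 : 0 < ρ := by positivity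
  set A := 4 * (M + 1) / r ^ 4 with hA
  have hA0 : 0 < A := by positivity
  let H : ℝ × ℝ × ℝ → ℝ := fun p => A * qq (p.1 - (ρ + C₁ * (p.2.2 - t₀)) ^ 2) + L * (p.2.2 - t₀)
  have hH : ContDiff ℝ 1 H := by
    refine ContDiff.add (contDiff_const.mul (qq_contDiff.comp (by fun_prop))) (by fun_prop)
  let φ : Dom n → ℝ := fun z => H (‖z.1 - x₀‖ ^ 2, z.2.1, z.2.2)
  have hφc : Continuous φ := hH.continuous.comp (by fun_prop)
  let f : Dom n → ℝ := fun z => w z - φ z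
  have hfc : Continuous f := hc.sub hφc
  have hwM : ∀ z, w z ≤ M := fun z => (abs_le.1 (hM z)).2
  have hwM' : ∀ z, -M ≤ w z := fun z => (abs_le.1 (hM z)).1
  have hfz : f (x₀, 0, t₀) = w (x₀, 0, t₀) := by
    have : -(ρ ^ 2) ≤ 0 := by nlinarith [sq_nonneg ρ]
    simp [f, φ, H, qq, this]
  set T := 2 * M / L with hT
  have hT0 : 0 ≤ T := by positivity
  set B := 2 * M / A + 1 with hB
  have hB1 : 1 ≤ B := by
    have : 0 ≤ 2 * M / A := by positivity
    linarith
  have hAB : 2 * M ≤ A * B := by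
    rw [hB]; field_simp; linarith
  set R := ρ + C₁ * T + B with hR
  let K : Set (Dom n) := Metric.closedBall x₀ R ×ˢ (Metric.closedBall (0 : ℝ) 1 ×ˢ Set.Icc t₀ (t₀ + T))
  have hR0 : 0 ≤ R := by positivity
  obtain ⟨m, hmS, hmax⟩ := exists_max (S := {z : Dom n | t₀ ≤ z.2.2}) (K := K) hfc
    ((isCompact_closedBall _ _).prod ((isCompact_closedBall _ _).prod isCompact_Icc))
    (fun z hz => hz.2.2.1) ⟨(x₀, 0, t₀), by
      refine ⟨by simp [hR0], by simp, ?_, ?_⟩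
      · exact le_refl t₀
      · change t₀ ≤ t₀ + T
        linarith⟩ (by
    rintro ⟨x, y, t⟩ ht
    change t₀ ≤ t at ht
    have hbase : (x₀, 0, t₀) ∈ K := by
      refine ⟨by simp [hR0], by simp, ?_, ?_⟩
      · exact le_refl t₀
      · change t₀ ≤ t₀ + T
        linarith
    by_cases h1 : t₀ + T < t
    · refine ⟨_, hbase, ?_⟩
      rw [hfz]
      have e1 : L * T ≤ L * (t - t₀) := by gcongr; linarith
      have e2 : L * T = 2 * M := by rw [hT]; field_simp
      have e3 := qq_nonneg (‖x - x₀‖ ^ 2 - (ρ + C₁ * (t - t₀)) ^ 2)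
      have e4 := mul_nonneg hA0.le e3
      have e5 := hwM (x, y, t)
      have e6 := hwM' (x₀, 0, t₀)
      simp only [f, φ, H]
      linarith
    push Not at h1
    by_cases h3 : R < ‖x - x₀‖
    · refine ⟨_, hbase, ?_⟩
      rw [hfz]
      have e0 : 0 ≤ t - t₀ := by linarith
      have e1 : ρ + C₁ * (t - t₀) ≤ ρ + C₁ * T := by gcongr; linarith
      have e2 : B ≤ ‖x - x₀‖ ^ 2 - (ρ + C₁ * (t - t₀)) ^ 2 := by
        have a1 : (ρ + C₁ * (t - t₀)) ^ 2 ≤ (ρ + C₁ * T) ^ 2 := by gcongr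
        have a2 : R ^ 2 ≤ ‖x - x₀‖ ^ 2 := by gcongr
        have a3 : 0 ≤ ρ + C₁ * T := by positivity
        have a4 : (ρ + C₁ * T) ^ 2 + B ≤ R ^ 2 := by rw [hR]; nlinarith
        linarith
      have e3 : B ≤ qq (‖x - x₀‖ ^ 2 - (ρ + C₁ * (t - t₀)) ^ 2) := by
        rw [qq, max_eq_left (by linarith)]
        nlinarith
      have e4 : A * B ≤ A * qq (‖x - x₀‖ ^ 2 - (ρ + C₁ * (t - t₀)) ^ 2) := by gcongr
      have e5 := hwM (x, y, t)
      have e6 := hwM' (x₀, 0, t₀)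
      have e7 := mul_nonneg hLpos.le e0
      simp only [f, φ, H]
      linarith
    push Not at h3
    obtain ⟨_, a, _, _, ha, _⟩ := per_red x y t
    refine ⟨(x, y + a, t), ⟨by simpa [dist_eq_norm] using h3, by simpa using ha, ht, h1⟩, ?_⟩
    have := per_shift hp 0 a 0 x y t
    simp only [Int.cast_zero, add_zero] at this
    have e : x + intVec 0 = x := by ext i; simp [intVec]
    rw [e] at this
    simp only [f, φ, H, this]
    exact le_refl _)
  obtain ⟨x, y, t⟩ := m
  change t₀ ≤ t at hmS
  have hgoal : f (x, y, t) ≤ S + 1 := by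
    rcases hmS.lt_or_eq with htt | htt
    · exfalso
      set s := ‖x - x₀‖ ^ 2 - (ρ + C₁ * (t - t₀)) ^ 2 with hs
      obtain ⟨d0, d1, d2, d3⟩ := pd_of hH x₀ x y t (h1 := A * (2 * max s 0)) (h2 := 0)
        (h3 := A * (2 * max s 0 * (-(2 * (ρ + C₁ * (t - t₀)) * C₁))) + L)
        (by
          have b1 : HasDerivAt (fun r : ℝ => r - (ρ + C₁ * (t - t₀)) ^ 2) 1 (‖x - x₀‖ ^ 2) :=
            (hasDerivAt_id _).sub_const _
          have b2 := ((qq_comp b1).const_mul A).add_const (L * (t - t₀))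
          simpa [H] using b2)
        (by simp only [H]; exact hasDerivAt_const _ _)
        (by
          have b0 : HasDerivAt (fun r : ℝ => (ρ + C₁ * (r - t₀))) C₁ t := by
            simpa using (((hasDerivAt_id t).sub_const t₀).const_mul C₁).const_add ρ
          have b1 : HasDerivAt (fun r : ℝ => ‖x - x₀‖ ^ 2 - (ρ + C₁ * (r - t₀)) ^ 2)
              (-(2 * (ρ + C₁ * (t - t₀)) * C₁)) t := by
            simpa using (b0.pow 2).const_sub (‖x - x₀‖ ^ 2)
          have b3 : HasDerivAt (fun r : ℝ => L * (r - t₀)) L t := by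
            simpa using ((hasDerivAt_id t).sub_const t₀).const_mul L
          exact ((qq_comp b1).const_mul A).add b3)
      have hlm : IsLocalMax (fun z => w z - φ z) (x, y, t) := by
        have : {z : Dom n | t₀ < z.2.2} ∈ 𝓝 ((x, y, t) : Dom n) :=
          (isOpen_lt continuous_const (by fun_prop)).mem_nhds htt
        filter_upwards [this] with z hz
        exact hmax z (le_of_lt hz)
      have hv := hsub.2 φ d0 (x, y, t) hlm
      simp only [φ, d1, d2, d3] at hv
      have g1 := hG x y t ((2 * (A * (2 * max s 0))) • (x - x₀))
      have g2 := hlow (x, y, t)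
      have hs0 : 0 ≤ max s 0 := le_max_right _ _
      rw [norm_smul, Real.norm_eq_abs, abs_of_nonneg (by positivity)] at g1
      have g3 : 0 ≤ max s 0 * (‖x - x₀‖ - (ρ + C₁ * (t - t₀))) := by
        rcases le_or_gt s 0 with h | h
        · simp [max_eq_right h]
        · refine mul_nonneg hs0 ?_
          have : (ρ + C₁ * (t - t₀)) ^ 2 < ‖x - x₀‖ ^ 2 := by linarith
          have := abs_lt_of_sq_lt_sq this (norm_nonneg _)
          have := (abs_lt.1 this).2
          linarith
      have g4 : 0 ≤ 4 * A * C₁ * (max s 0 * (‖x - x₀‖ - (ρ + C₁ * (t - t₀)))) := by positivity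
      have g5 : A * (2 * max s 0 * (-(2 * (ρ + C₁ * (t - t₀)) * C₁))) +
          C₁ * (2 * (A * (2 * max s 0)) * ‖x - x₀‖) =
          4 * A * C₁ * (max s 0 * (‖x - x₀‖ - (ρ + C₁ * (t - t₀)))) := by ring
      linarith
    · subst htt
      have e3 := qq_nonneg (‖x - x₀‖ ^ 2 - (ρ + C₁ * (t₀ - t₀)) ^ 2)
      have e4 := mul_nonneg hA0.le e3
      by_cases hxr : ‖x - x₀‖ < r
      · have := huc x y t₀ x₀ y t₀ hxr (by simpa using hr) (by simpa using hr)
        have h1 := (abs_lt.1 this).2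
        have h2 := hS y
        simp only [f, φ, H]
        linarith
      · push Not at hxr
        have e5 := hwM (x, y, t₀)
        have e6 := hwM' (x₀, 0, t₀)
        have e7 := hS 0
        have a2 : r ^ 2 ≤ ‖x - x₀‖ ^ 2 := by gcongr
        have e8 : 3 / 4 * r ^ 2 ≤ ‖x - x₀‖ ^ 2 - (ρ + C₁ * (t₀ - t₀)) ^ 2 := by
          rw [sub_self, mul_zero, add_zero, hρ]; nlinarith
        have e9 : (3 / 4 * r ^ 2) ^ 2 ≤ qq (‖x - x₀‖ ^ 2 - (ρ + C₁ * (t₀ - t₀)) ^ 2) := by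
          rw [qq]
          gcongr
          exact e8.trans (le_max_left _ _)
        have e10 : A * (3 / 4 * r ^ 2) ^ 2 ≤ A * qq (‖x - x₀‖ ^ 2 - (ρ + C₁ * (t₀ - t₀)) ^ 2) := by
          gcongr
        have e11 : A * (3 / 4 * r ^ 2) ^ 2 = 9 / 4 * (M + 1) := by
          rw [hA]; field_simp; norm_num
        simp only [f, φ, H]
        linarith
  have hfin := (hmax (x₁, y₁, t₁) ht).trans hgoal
  have hq : qq (‖x₁ - x₀‖ ^ 2 - (ρ + C₁ * (t₁ - t₀)) ^ 2) = 0 := by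
    have : ‖x₁ - x₀‖ ^ 2 ≤ (ρ + C₁ * (t₁ - t₀)) ^ 2 := by
      gcongr; linarith
    rw [qq, max_eq_right (by linarith)]; norm_num
  simp only [f, φ, H, hq] at hfin
  linarith

/-! ### Part 5: doubling of variables -/

/-- The doubled functional. -/
def Phi {n : ℕ} (w : Dom n → ℝ) (c σ A D : ℝ) (x : Euc n) (y t : ℝ) (x' : Euc n) (y' s : ℝ) : ℝ :=
  w (x, y, t) - w (x', y', s) -
    (c * (σ * (y' - y)) + A * qq (-(σ * (y' - y))) + A * (t - s) ^ 2 + D * ‖x - x'‖ ^ 2)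

lemma qq_pen {c A : ℝ} (hc : 0 ≤ c) (hA : 0 < A) (k : ℝ) : -(c ^ 2 / (4 * A)) ≤ c * k + A * qq (-k) := by
  rcases le_total k 0 with h | h
  · rw [qq, max_eq_left (by linarith)]
    have e : c * k + A * (-k) ^ 2 + c ^ 2 / (4 * A) = (2 * A * k + c) ^ 2 / (4 * A) := by
      field_simp; ring
    have : 0 ≤ (2 * A * k + c) ^ 2 / (4 * A) := by positivity
    linarith
  · have h1 := qq_nonneg (-k)
    have : 0 ≤ c ^ 2 / (4 * A) := by positivity
    have : 0 ≤ c * k := by positivity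
    have : 0 ≤ A * qq (-k) := by positivity
    linarith

lemma dbl_max {n : ℕ} {w : Dom n → ℝ} (hp : STPeriodic w) (hw : Continuous w) {c σ A D : ℝ}
    (hc : 0 < c) (hσ : |σ| = 1) (hA : 1 ≤ A) (hD : 1 ≤ D) :
    ∃ x y t x' y' s, ∀ X Y T X' Y' S, Phi w c σ A D X Y T X' Y' S ≤ Phi w c σ A D x y t x' y' s := by
  obtain ⟨M, hM0, hM⟩ := per_bdd hp hw
  have hwM : ∀ z, w z ≤ M := fun z => (abs_le.1 (hM z)).2
  have hwM' : ∀ z, -M ≤ w z := fun z => (abs_le.1 (hM z)).1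
  let f : Dom n × Dom n → ℝ := fun p => Phi w c σ A D p.1.1 p.1.2.1 p.1.2.2
    (p.1.1 + p.2.1) (p.1.2.1 + p.2.2.1) (p.1.2.2 + p.2.2.2)
  have hf : Continuous f := by
    have := qq_contDiff.continuous
    simp only [f, Phi]
    fun_prop
  set R := 1 + 2 * M + c + c ^ 2 + 2 * M / c with hR
  have hMc : 0 ≤ 2 * M / c := by positivity
  have hc2 : 0 ≤ c ^ 2 := by positivity
  have hR1 : 1 ≤ R := by linarith
  have hf0 : f 0 = 0 := by
    simp [f, Phi, qq]
    exact sub_self _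
  obtain ⟨m, -, hm⟩ := exists_max (S := Set.univ)
    (K := Metric.closedBall (0 : Dom n) (n + 1) ×ˢ Metric.closedBall (0 : Dom n) R) hf
    ((isCompact_closedBall _ _).prod (isCompact_closedBall _ _)) (Set.subset_univ _)
    ⟨0, by simp; positivity, by simp; linarith⟩ (by
      rintro ⟨⟨x, y, t⟩, ⟨ξ, h, τ⟩⟩ -
      by_cases hd : ‖((ξ, h, τ) : Dom n)‖ ≤ R
      · obtain ⟨k, a, b, hk⟩ := per_red' x y t
        refine ⟨((x + intVec k, y + a, t + b), (ξ, h, τ)), ⟨by simpa using hk, by simpa using hd⟩, ?_⟩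
        apply le_of_eq
        have e1 := per_shift hp k a b x y t
        have e2 := per_shift hp k a b (x + ξ) (y + h) (t + τ)
        simp only [f, Phi]
        rw [e1, show x + intVec k + ξ = x + ξ + intVec k by abel,
          show y + (a : ℝ) + h = y + h + a by ring, show t + (b : ℝ) + τ = t + τ + b by ring, e2]
        rw [show y + h + (a : ℝ) - (y + a) = y + h - y by ring,
          show t + (b : ℝ) - (t + τ + b) = t - (t + τ) by ring,
          show x + intVec k - (x + ξ + intVec k) = x - (x + ξ) by abel]
      · refine ⟨0, ⟨by simp; positivity, by simp; linarith⟩, ?_⟩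
        rw [hf0]
        have w1 := hwM (x, y, t)
        have w2 := hwM' (x + ξ, y + h, t + τ)
        have q0 := qq_pen hc.le (by linarith : 0 < A) (σ * h)
        have q1 : c ^ 2 / (4 * A) ≤ c ^ 2 := by
          apply div_le_self hc2; linarith
        have t0 : 0 ≤ A * τ ^ 2 := by positivity
        have x0 : 0 ≤ D * ‖ξ‖ ^ 2 := by positivity
        have key : 2 * M ≤ c * (σ * h) + A * qq (-(σ * h)) + A * τ ^ 2 + D * ‖ξ‖ ^ 2 := by
          simp only [Prod.norm_def, Real.norm_eq_abs, sup_le_iff, not_and_or, not_le] at hd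
          rcases hd with hd | hd | hd
          · have : R ≤ ‖ξ‖ ^ 2 := by nlinarith
            have : ‖ξ‖ ^ 2 ≤ D * ‖ξ‖ ^ 2 := le_mul_of_one_le_left (by positivity) hD
            linarith
          · have hk : R < |σ * h| := by rwa [abs_mul, hσ, one_mul]
            rcases lt_abs.1 hk with hk | hk
            · have a1 : 2 * M ≤ c * R := by
                have : c * (2 * M / c) = 2 * M := by field_simp
                have : c * (2 * M / c) ≤ c * R := by gcongr; linarith
                linarith
              have a2 : c * R ≤ c * (σ * h) := by gcongr
              have a3 := mul_nonneg (by linarith : 0 ≤ A) (qq_nonneg (-(σ * h)))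
              linarith
            · have a3 : qq (-(σ * h)) = (-(σ * h)) ^ 2 := by rw [qq, max_eq_left (by linarith)]
              rw [a3]
              have a4 : (-(σ * h)) ^ 2 ≤ A * (-(σ * h)) ^ 2 := le_mul_of_one_le_left (by positivity) hA
              have a5 : 2 * M ≤ (-(σ * h)) * ((-(σ * h)) - c) := by
                nlinarith
              nlinarith
          · have : R ≤ τ ^ 2 := by rw [← sq_abs]; nlinarith
            have : τ ^ 2 ≤ A * τ ^ 2 := le_mul_of_one_le_left (by positivity) hA
            linarith
        have e1 : y + h - y = h := by ring
        have e2 : (t - (t + τ)) ^ 2 = τ ^ 2 := by ring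
        have e3 : ‖x - (x + ξ)‖ = ‖ξ‖ := by rw [sub_add_cancel_left, norm_neg]
        simp only [f, Phi, e1, e2, e3]
        linarith)
  refine ⟨m.1.1, m.1.2.1, m.1.2.2, m.1.1 + m.2.1, m.1.2.1 + m.2.2.1, m.1.2.2 + m.2.2.2, ?_⟩
  intro X Y T X' Y' S
  have := hm ((X, Y, T), (X' - X, Y' - Y, S - T)) trivial
  simpa [f] using this

lemma dbl_visc {n : ℕ} {G : Ham n} {w : Dom n → ℝ} {α c σ A D : ℝ} (hs : ViscSol G α 0 w)
    {x : Euc n} {y t : ℝ} {x' : Euc n} {y' s : ℝ}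
    (hm : ∀ X Y T X' Y' S, Phi w c σ A D X Y T X' Y' S ≤ Phi w c σ A D x y t x' y' s) :
    2 * A * (t - s) + G x y t ((2 * D) • (x - x')) (σ * (2 * A * max (-(σ * (y' - y))) 0 - c))
      + α * w (x, y, t) ≤ 0 ∧
    0 ≤ 2 * A * (t - s) + G x' y' s ((2 * D) • (x - x')) (σ * (2 * A * max (-(σ * (y' - y))) 0 - c))
      + α * w (x', y', s) := by
  constructor
  · let H : ℝ × ℝ × ℝ → ℝ := fun p => c * (σ * (y' - p.2.1)) + A * qq (-(σ * (y' - p.2.1))) +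
      A * (p.2.2 - s) ^ 2 + D * p.1
    have hH : ContDiff ℝ 1 H := by
      refine ContDiff.add (ContDiff.add (ContDiff.add (by fun_prop)
        (contDiff_const.mul (qq_contDiff.comp (by fun_prop)))) (by fun_prop)) (by fun_prop)
    obtain ⟨d0, d1, d2, d3⟩ := pd_of hH x' x y t (h1 := D)
      (h2 := σ * (2 * A * max (-(σ * (y' - y))) 0 - c)) (h3 := 2 * A * (t - s))
      (by
        simpa [H] using ((hasDerivAt_id (‖x - x'‖ ^ 2)).const_mul D).const_add
          (c * (σ * (y' - y)) + A * qq (-(σ * (y' - y))) + A * (t - s) ^ 2))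
      (by
        have b0 : HasDerivAt (fun r : ℝ => σ * (y' - r)) (-σ) y := by
          simpa using ((hasDerivAt_id y).const_sub y').const_mul σ
        have b1 := (((b0.const_mul c).add ((qq_comp b0.neg).const_mul A)).add_const
          (A * (t - s) ^ 2)).add_const (D * ‖x - x'‖ ^ 2)
        refine b1.congr_deriv ?_
        simp only [Pi.neg_apply]
        ring)
      (by
        have b1 := ((((hasDerivAt_id t).sub_const s).pow 2).const_mul A).const_add
          (c * (σ * (y' - y)) + A * qq (-(σ * (y' - y)))) |>.add_const (D * ‖x - x'‖ ^ 2)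
        refine b1.congr_deriv ?_
        simp
        ring)
    have hv := hs.2.1.2 _ d0 (x, y, t) (Eventually.of_forall fun z => by
      have := hm z.1 z.2.1 z.2.2 x' y' s
      simp only [Phi] at this
      simp only [H]
      linarith)
    rw [d1, d2, d3] at hv
    exact hv
  · let H : ℝ × ℝ × ℝ → ℝ := fun p => -(c * (σ * (p.2.1 - y)) + A * qq (-(σ * (p.2.1 - y))) +
      A * (t - p.2.2) ^ 2 + D * p.1)
    have hH : ContDiff ℝ 1 H := by
      refine ContDiff.neg (ContDiff.add (ContDiff.add (ContDiff.add (by fun_prop)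
        (contDiff_const.mul (qq_contDiff.comp (by fun_prop)))) (by fun_prop)) (by fun_prop))
    obtain ⟨d0, d1, d2, d3⟩ := pd_of hH x x' y' s (h1 := -D)
      (h2 := σ * (2 * A * max (-(σ * (y' - y))) 0 - c)) (h3 := 2 * A * (t - s))
      (by
        have b1 := (((hasDerivAt_id (‖x' - x‖ ^ 2)).const_mul D).const_add
          (c * (σ * (y' - y)) + A * qq (-(σ * (y' - y))) + A * (t - s) ^ 2)).neg
        refine b1.congr_deriv ?_
        simp)
      (by
        have b0 : HasDerivAt (fun r : ℝ => σ * (r - y)) σ y' := by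
          simpa using ((hasDerivAt_id y').sub_const y).const_mul σ
        have b1 := ((((b0.const_mul c).add ((qq_comp b0.neg).const_mul A)).add_const
          (A * (t - s) ^ 2)).add_const (D * ‖x' - x‖ ^ 2)).neg
        refine b1.congr_deriv ?_
        simp only [Pi.neg_apply]
        ring)
      (by
        have b1 := (((((hasDerivAt_id s).const_sub t).pow 2).const_mul A).const_add
          (c * (σ * (y' - y)) + A * qq (-(σ * (y' - y)))) |>.add_const (D * ‖x' - x‖ ^ 2)).neg
        refine b1.congr_deriv ?_
        simp
        ring)
    have hv := hs.2.2.2 _ d0 (x', y', s) (Eventually.of_forall fun z => by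
      have := hm x y t z.1 z.2.1 z.2.2
      simp only [Phi] at this
      simp only [H]
      rw [norm_sub_rev z.1 x, norm_sub_rev x' x]
      linarith)
    rw [d1, d2, d3] at hv
    have e : (2 * -D) • (x' - x) = (2 * D) • (x - x') := by
      rw [mul_neg, neg_smul, ← smul_neg, neg_sub]
    rw [e] at hv
    exact hv

/-! ### Part 6: one-sided Lipschitz bound in y -/

lemma small_of {A T Q r : ℝ} (hA : 0 ≤ A) (hr : 0 < r) (h : A * T ^ 2 ≤ Q) (hQ : Q / r ^ 2 < A) : T < r := by
  by_contra hT
  push Not at hT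
  rw [div_lt_iff₀ (by positivity)] at hQ
  have : r ^ 2 ≤ T ^ 2 := by gcongr
  have : A * r ^ 2 ≤ A * T ^ 2 := by gcongr
  linarith

lemma G_int_y {n : ℕ} {G : Ham n} (h1 : HypH1 G) (x : Euc n) (y t : ℝ) (px : Euc n) (py : ℝ) (a : ℤ) :
    G x (y + a) t px py = G x y t px py := by
  have hper : Function.Periodic (fun y => G x y t px py) 1 := fun y => h1.2.2.1 x y t px py
  have := hper.int_mul a y
  simpa using this

lemma y_diff {n : ℕ} {G : Ham n} {l C₃ C₄ C₅ : ℝ} (h1 : HypH1 G) (h3 : HypH3 G l C₃ C₄ C₅)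
    {σ η A : ℝ} (hσ : |σ| = 1) (hl : l = σ * |l|) (hη : 0 < η) (hA : 0 ≤ A) (x : Euc n) (y y' t : ℝ) (px : Euc n)
    {km : ℝ} (hkm : km = max (-(σ * (y' - y))) 0) (hkm1 : km ≤ 1) :
    |G x y' t px (σ * (2 * A * km - (|l| + η))) - G x y t px (σ * (2 * A * km - (|l| + η)))|
      ≤ C₃ * η + 2 * C₃ * (A * km ^ 2) := by
  have hC₃ := h3.1
  have e0 : σ * (2 * A * km - (|l| + η)) + l = σ * (2 * A * km - η) := by
    conv_lhs => rw [show σ * (2 * A * km - (|l| + η)) + l = σ * (2 * A * km - η) - σ * |l| + l by ring]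
    rw [← hl]; ring
  have hpy : |σ * (2 * A * km - (|l| + η)) + l| = |2 * A * km - η| := by
    rw [e0, abs_mul, hσ, one_mul]
  generalize σ * (2 * A * km - (|l| + η)) = py at hpy ⊢
  rcases le_total 0 (σ * (y' - y)) with h | h
  · have hk0 : km = 0 := by rw [hkm]; exact max_eq_right (by linarith)
    have hpy' : |py + l| = η := by rw [hpy, hk0]; simp [abs_of_pos hη]
    have hf0 := Int.fract_nonneg (y' - y)
    have hf1 := (Int.fract_lt_one (y' - y)).le
    have := reg_y h1 h3 x y t px py (Int.fract (y' - y))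
    rw [← G_int_y h1 x y' t px py (-⌊y' - y⌋)]
    have e : y' + ((-⌊y' - y⌋ : ℤ) : ℝ) = y + Int.fract (y' - y) := by
      rw [Int.fract]; push_cast; ring
    rw [e]
    rw [hpy', abs_of_nonneg hf0] at this
    have h2 : C₃ * η * Int.fract (y' - y) ≤ C₃ * η := mul_le_of_le_one_right (by positivity) hf1
    rw [hk0]
    linarith
  · have hk0 : km = -(σ * (y' - y)) := by rw [hkm]; exact max_eq_left (by linarith)
    have hka : |y' - y| = km := by
      rw [hk0, ← abs_of_nonpos h, abs_mul, hσ, one_mul]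
    have hk00 : 0 ≤ km := by rw [← hka]; positivity
    have := reg_y h1 h3 x y t px py (y' - y)
    rw [hka, hpy, add_sub_cancel] at this
    have h2 : |2 * A * km - η| ≤ 2 * A * km + η := by
      rw [abs_le]; constructor <;> nlinarith [mul_nonneg hA hk00]
    have h3 : C₃ * |2 * A * km - η| * km ≤ C₃ * (2 * A * km + η) * km := by gcongr
    have h4 : C₃ * η * km ≤ C₃ * η := mul_le_of_le_one_right (by positivity) hkm1
    nlinarith

lemma G_low {n : ℕ} {G : Ham n} {l C₁ C₂ C₃ C₄ C₅ : ℝ} (h1 : HypH1 G) (h2 : HypH2 G C₁ C₂)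
    (h3 : HypH3 G l C₃ C₄ C₅) (x : Euc n) (y t : ℝ) (px : Euc n) (py : ℝ) :
    C₁ * ‖px‖ - C₂ - C₅ * |py| ≤ G x y t px py := by
  have a := reg_p h1 h3 x y t px 0 py
  have b := h2.2.2 x y t px
  rw [zero_add] at a
  have := (abs_le.1 a).1
  linarith

set_option maxHeartbeats 2000000 in
lemma mono_y {n : ℕ} {G : Ham n} {l C₁ C₂ C₃ C₄ C₅ : ℝ} (h1 : HypH1 G) (h2 : HypH2 G C₁ C₂)
    (h3 : HypH3 G l C₃ C₄ C₅) {α : ℝ} (hα : 0 < α) {w : Dom n → ℝ} (hp : STPeriodic w)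
    (hs : ViscSol G α 0 w) {σ : ℝ} (hσ : |σ| = 1) (hl : l = σ * |l|) {k0 : ℝ} (hk0 : 0 ≤ k0)
    (x0 : Euc n) (y0 t0 : ℝ) : w (x0, y0, t0) - w (x0, y0 + σ * k0, t0) ≤ |l| * k0 := by
  by_contra hcon
  push Not at hcon
  have hw := hs.1
  have hC₁ := h2.1
  have hC₂ := h2.2.1
  obtain ⟨hC₃, hC₄, hC₅, -⟩ := id h3
  have hσ2 : σ * σ = 1 := by rw [← abs_mul_abs_self, hσ]; norm_num
  obtain ⟨M, hM0, hM⟩ := per_bdd hp hw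
  obtain ⟨κ, hκ, hm⟩ : ∃ κ > 0, 4 * κ = w (x0, y0, t0) - w (x0, y0 + σ * k0, t0) - |l| * k0 :=
    ⟨(w (x0, y0, t0) - w (x0, y0 + σ * k0, t0) - |l| * k0) / 4, by linarith, by ring⟩
  have hακ : 0 < α * κ := by positivity
  -- the small slope
  obtain ⟨η, hη, hη1, hηk, hηC⟩ : ∃ η > 0, η ≤ 1 ∧ η * k0 ≤ 2 * κ ∧ C₃ * η ≤ α * κ / 8 := by
    refine ⟨min 1 (min (2 * κ / (k0 + 1)) (α * κ / (8 * (C₃ + 1)))), by positivity, min_le_left _ _, ?_, ?_⟩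
    · have : min 1 (min (2 * κ / (k0 + 1)) (α * κ / (8 * (C₃ + 1)))) ≤ 2 * κ / (k0 + 1) :=
        (min_le_right _ _).trans (min_le_left _ _)
      calc _ ≤ 2 * κ / (k0 + 1) * (k0 + 1) := by gcongr; linarith
        _ = 2 * κ := by field_simp
    · have : min 1 (min (2 * κ / (k0 + 1)) (α * κ / (8 * (C₃ + 1)))) ≤ α * κ / (8 * (C₃ + 1)) :=
        (min_le_right _ _).trans (min_le_right _ _)
      calc _ ≤ (C₃ + 1) * (α * κ / (8 * (C₃ + 1))) := by gcongr; linarith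
        _ = α * κ / 8 := by field_simp
  obtain ⟨c', hc'⟩ : ∃ c', c' = |l| + η := ⟨_, rfl⟩
  have hc'0 : 0 < c' := by rw [hc']; positivity
  obtain ⟨c, hc⟩ : ∃ c, c = |l| + 1 := ⟨_, rfl⟩
  have hcc' : c' ≤ c := by linarith
  have hc0 : 0 < c := by linarith
  have hc2 : c' ^ 2 ≤ c ^ 2 := by gcongr
  -- tolerance
  obtain ⟨ε, hε, hε1⟩ : ∃ ε > 0, (2 * C₃ + 2 * C₄ * (3 + C₅)) * (4 * ε) ≤ α * κ / 8 := by
    have hB : 0 ≤ 2 * C₃ + 2 * C₄ * (3 + C₅) := by positivity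
    generalize 2 * C₃ + 2 * C₄ * (3 + C₅) = B at hB ⊢
    refine ⟨α * κ / (32 * (B + 1)), by positivity, ?_⟩
    calc _ ≤ (B + 1) * (4 * (α * κ / (32 * (B + 1)))) := by gcongr; linarith
      _ = α * κ / 8 := by field_simp; norm_num
  obtain ⟨r, hr, hrw⟩ := per_uc hp hw hε
  obtain ⟨cc, hcc⟩ : ∃ cc, cc = 1 + (1 + C₅) * c + α * M + C₂ := ⟨_, rfl⟩
  have hcc0 : 0 ≤ cc := by rw [hcc]; positivity
  obtain ⟨r0, hr0, hr0r, hr01, hr0c, hr0C⟩ : ∃ r0 > 0, r0 ≤ r ∧ r0 ≤ 1 ∧ 2 * C₄ * (cc * r0) ≤ α * κ / 8 ∧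
      C₄ * r0 ≤ 1 / 2 := by
    have hB : 0 ≤ 2 * C₄ * cc := by positivity
    refine ⟨min (min r 1) (min (α * κ / (8 * (2 * C₄ * cc + 1))) (1 / (2 * (C₄ + 1)))), by positivity,
      (min_le_left _ _).trans (min_le_left _ _), (min_le_left _ _).trans (min_le_right _ _), ?_, ?_⟩
    · have := (min_le_right (min r 1) (min (α * κ / (8 * (2 * C₄ * cc + 1))) (1 / (2 * (C₄ + 1))))).trans
        (min_le_left _ _)
      rw [← mul_assoc]
      generalize 2 * C₄ * cc = B at hB this ⊢
      calc _ ≤ (B + 1) * (α * κ / (8 * (B + 1))) := by gcongr; linarith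
        _ = α * κ / 8 := by field_simp
    · have := (min_le_right (min r 1) (min (α * κ / (8 * (2 * C₄ * cc + 1))) (1 / (2 * (C₄ + 1))))).trans
        (min_le_right _ _)
      calc _ ≤ (C₄ + 1) * (1 / (2 * (C₄ + 1))) := by gcongr; linarith
        _ = 1 / 2 := by field_simp
  obtain ⟨Q, hQ⟩ : ∃ Q, Q = 2 * M + c ^ 2 := ⟨_, rfl⟩
  have hQ0 : 0 < Q := by rw [hQ]; positivity
  obtain ⟨A, hA1, hA2, hA3, hA4⟩ : ∃ A : ℝ, 1 ≤ A ∧ c ^ 2 / (4 * κ) ≤ A ∧ c ^ 2 / (2 * ε) ≤ A ∧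
      2 * Q / r0 ^ 2 < A := by
    have q1 : 0 ≤ c ^ 2 / (4 * κ) := by positivity
    have q2 : 0 ≤ c ^ 2 / (2 * ε) := by positivity
    have q3 : 0 ≤ 2 * Q / r0 ^ 2 := by positivity
    exact ⟨1 + c ^ 2 / (4 * κ) + c ^ 2 / (2 * ε) + 2 * Q / r0 ^ 2, by linarith, by linarith, by linarith,
      by linarith⟩
  have hA0 : 0 < A := by linarith
  have hA2' : c ^ 2 / (4 * A) ≤ κ := by
    rw [div_le_iff₀ (by positivity)] at hA2 ⊢; linarith
  have hA3' : c ^ 2 / (2 * A) ≤ ε := by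
    rw [div_le_iff₀ (by positivity)] at hA3 ⊢; linarith
  obtain ⟨R, hR⟩ : ∃ R, R = c + 2 * A + (2 * A + α * M + C₅ * (c + 2 * A) + C₂) / C₁ := ⟨_, rfl⟩
  obtain ⟨r1, hr1, hGu⟩ := G_uc h1 R (ε := α * κ / 4) (by positivity)
  obtain ⟨D, hDA, hD⟩ : ∃ D : ℝ, A ≤ D ∧ Q / r1 ^ 2 < D := by
    have q1 : 0 ≤ Q / r1 ^ 2 := by positivity
    exact ⟨A + Q / r1 ^ 2, by linarith, by linarith⟩
  obtain ⟨x, y, t, x', y', s, hmax⟩ := dbl_max hp hw hc'0 hσ hA1 (hA1.trans hDA)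
  obtain ⟨hv1, hv2⟩ := dbl_visc hs hmax
  obtain ⟨km, hkm⟩ : ∃ km, km = max (-(σ * (y' - y))) 0 := ⟨_, rfl⟩
  have hkm0 : 0 ≤ km := by rw [hkm]; exact le_max_right _ _
  obtain ⟨kp, hkp⟩ : ∃ kp, kp = max (σ * (y' - y)) 0 := ⟨_, rfl⟩
  have hkp0 : 0 ≤ kp := by rw [hkp]; exact le_max_right _ _
  have hkk : kp - km = σ * (y' - y) := by
    rw [hkp, hkm]
    rcases le_total 0 (σ * (y' - y)) with h | h
    · rw [max_eq_left h, max_eq_right (by linarith)]; ring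
    · rw [max_eq_right h, max_eq_left (by linarith)]; ring
  have hqk : qq (-(σ * (y' - y))) = km ^ 2 := by rw [qq, hkm]
  rw [← hkm] at hv1 hv2
  obtain ⟨T, hT⟩ : ∃ T, T = |t - s| := ⟨_, rfl⟩
  have hT0 : 0 ≤ T := by rw [hT]; positivity
  have hT2 : (t - s) ^ 2 = T ^ 2 := by rw [hT, sq_abs]
  -- first comparison
  have cmp1 : A * T ^ 2 + D * ‖x - x'‖ ^ 2 + A * km ^ 2 - c' * km ≤
      w (x, y + σ * kp, t) - w (x', y', s) := by
    have := hmax x y t x (y + σ * kp) t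
    simp only [Phi] at this
    rw [hqk, hT2, show σ * (y + σ * kp - y) = (σ * σ) * kp by ring, hσ2, one_mul, ← hkk] at this
    rw [show qq (-kp) = 0 by rw [qq, max_eq_right (by linarith)]; norm_num] at this
    simp at this
    linarith
  have hyy : |y + σ * kp - y'| = km := by
    have : y + σ * kp - y' = σ * km := by
      have : kp = km + σ * (y' - y) := by linarith
      rw [this]
      linear_combination (y' - y) * hσ2
    rw [this, abs_mul, hσ, one_mul, abs_of_nonneg hkm0]
  have hyoung : A / 2 * km ^ 2 - c ^ 2 / (2 * A) ≤ A * km ^ 2 - c' * km := by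
    have e : A / 2 * km ^ 2 + c ^ 2 / (2 * A) - c * km = (A * km - c) ^ 2 / (2 * A) := by
      field_simp; ring
    have : 0 ≤ (A * km - c) ^ 2 / (2 * A) := by positivity
    have : c' * km ≤ c * km := by gcongr
    linarith
  have hcA : c ^ 2 / (2 * A) ≤ c ^ 2 := div_le_self (by positivity) (by linarith)
  have pT : 0 ≤ A * T ^ 2 := by positivity
  have pX : 0 ≤ D * ‖x - x'‖ ^ 2 := mul_nonneg (by linarith) (by positivity)
  have pk : 0 ≤ A * km ^ 2 := by positivity
  have hQA : Q / r0 ^ 2 < A := by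
    refine lt_of_le_of_lt ?_ hA4
    gcongr; linarith
  obtain ⟨hTr, hkr, hXr, hXr1⟩ : T < r0 ∧ km < r0 ∧ ‖x - x'‖ < r0 ∧ ‖x - x'‖ < r1 := by
    have a1 := (abs_le.1 (hM (x, y + σ * kp, t))).2
    have a2 := (abs_le.1 (hM (x', y', s))).1
    refine ⟨small_of hA0.le hr0 (Q := Q) (by linarith) hQA,
      small_of hA0.le hr0 (Q := 2 * Q) (by linarith) hA4,
      small_of (A := D) (by linarith) hr0 (Q := Q) (by linarith) (by linarith),
      small_of (A := D) (by linarith) hr1 (Q := Q) (by linarith) hD⟩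
  have he : A * (T ^ 2 + km ^ 2) ≤ 4 * ε := by
    have := (abs_lt.1 (hrw x (y + σ * kp) t x' y' s (by linarith) (by rw [hyy]; linarith)
      (by rw [← hT]; linarith))).2
    linarith
  -- second comparison
  have hdiff : κ ≤ w (x, y, t) - w (x', y', s) := by
    have := hmax x0 y0 t0 x0 (y0 + σ * k0) t0
    simp only [Phi] at this
    rw [show σ * (y0 + σ * k0 - y0) = (σ * σ) * k0 by ring, hσ2, one_mul] at this
    rw [show qq (-k0) = 0 by rw [qq, max_eq_right (by linarith)]; norm_num] at this
    simp at this
    have q := qq_pen hc'0.le hA0 (σ * (y' - y))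
    have q1 : c' ^ 2 / (4 * A) ≤ c ^ 2 / (4 * A) := by gcongr
    have q2 : A * (t - s) ^ 2 = A * T ^ 2 := by rw [hT2]
    have q3 : c' * k0 = |l| * k0 + η * k0 := by rw [hc']; ring
    linarith
  -- bounds on the gradient
  rw [hc'] at hv1 hv2
  have hyd := y_diff h1 h3 hσ hl hη hA0.le x y y' s ((2 * D) • (x - x')) hkm (by linarith)
  have hpy : |σ * (2 * A * km - (|l| + η))| ≤ c + 2 * A * km := by
    rw [abs_mul, hσ, one_mul, ← hc', abs_le]
    have : 0 ≤ 2 * A * km := by positivity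
    constructor <;> linarith
  generalize σ * (2 * A * km - (|l| + η)) = py at hv1 hv2 hyd hpy
  generalize (2 * D) • (x - x') = px at hv1 hv2 hyd
  have hTabs := abs_le.1 hT.ge
  have hGup : G x y t px py ≤ 2 * A * T + α * M := by
    have a1 : -(α * M) ≤ α * w (x, y, t) := by
      have := (abs_le.1 (hM (x, y, t))).1
      have := mul_le_mul_of_nonneg_left this hα.le
      linarith
    have a2 : 2 * A * (-T) ≤ 2 * A * (t - s) := by gcongr; exact hTabs.1
    linarith
  have hGlo := G_low h1 h2 h3 x y t px py
  have hC5 : C₅ * |py| ≤ C₅ * (c + 2 * A * km) := by gcongr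
  have hpxn : 0 ≤ C₁ * ‖px‖ := by positivity
  have hαM : 0 ≤ α * M := by positivity
  have hAT0 : 0 ≤ 2 * A * T := by positivity
  have hGabs : |G x y t px py| ≤ 2 * A * T + α * M + C₂ + C₅ * (c + 2 * A * km) := by
    have : 0 ≤ C₅ * (c + 2 * A * km) := by positivity
    rw [abs_le]; constructor <;> linarith
  have hAk : 2 * A * km ≤ 2 * A := mul_le_of_le_one_right (by positivity) (by linarith)
  have hAT : 2 * A * T ≤ 2 * A := mul_le_of_le_one_right (by positivity) (by linarith)
  have hpyR : |py| ≤ R := by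
    have : 0 ≤ (2 * A + α * M + C₅ * (c + 2 * A) + C₂) / C₁ := by positivity
    linarith
  have hpxR : ‖px‖ ≤ R := by
    have a1 : ‖px‖ ≤ (2 * A + α * M + C₅ * (c + 2 * A) + C₂) / C₁ := by
      rw [le_div_iff₀ hC₁]
      have : C₅ * (c + 2 * A * km) ≤ C₅ * (c + 2 * A) := by gcongr
      linarith
    linarith
  have hxd := (abs_lt.1 (hGu x x' y' s px py hXr1 hpxR hpyR)).1
  have hyd' := (abs_le.1 hyd).2
  have hCT : C₄ * |s - t| ≤ 1 / 2 := by
    rw [abs_sub_comm, ← hT]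
    exact le_trans (by gcongr) hr0C
  have htd := reg_t h1 h3 x y t px py (s - t) hCT
  rw [add_sub_cancel, abs_sub_comm s t, ← hT] at htd
  have htd' := (abs_le.1 htd).2
  have hfin : 2 * C₄ * T * (1 + |py| + |G x y t px py|) ≤
      2 * C₄ * (cc * r0) + 2 * C₄ * (3 + C₅) * (A * (T ^ 2 + km ^ 2)) := by
    have a1 : T * (1 + |py| + |G x y t px py|) ≤
        T * (1 + (c + 2 * A * km) + (2 * A * T + α * M + C₂ + C₅ * (c + 2 * A * km))) := by gcongr
    have a2 : T * (1 + (c + 2 * A * km) + (2 * A * T + α * M + C₂ + C₅ * (c + 2 * A * km))) =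
        cc * T + 2 * (A * T ^ 2) + (1 + C₅) * (A * (2 * km * T)) := by rw [hcc]; ring
    have a3 : A * (2 * km * T) ≤ A * (T ^ 2 + km ^ 2) := by
      have := two_mul_le_add_sq km T
      gcongr; linarith
    have a4 : (1 + C₅) * (A * (2 * km * T)) ≤ (1 + C₅) * (A * (T ^ 2 + km ^ 2)) := by gcongr
    have a5 : cc * T ≤ cc * r0 := by gcongr
    have a6 : T * (1 + |py| + |G x y t px py|) ≤ cc * r0 + (3 + C₅) * (A * (T ^ 2 + km ^ 2)) := by
      have a7 : (3 + C₅) * (A * (T ^ 2 + km ^ 2)) =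
          2 * (A * T ^ 2) + 2 * (A * km ^ 2) + (1 + C₅) * (A * (T ^ 2 + km ^ 2)) := by ring
      rw [a7]
      linarith only [a1, a2, a4, a5, pk]
    calc _ = 2 * C₄ * (T * (1 + |py| + |G x y t px py|)) := by ring
      _ ≤ 2 * C₄ * (cc * r0 + (3 + C₅) * (A * (T ^ 2 + km ^ 2))) := by gcongr
      _ = _ := by ring
  have hfin2 : 2 * C₃ * (A * km ^ 2) ≤ 2 * C₃ * (A * (T ^ 2 + km ^ 2)) := by
    gcongr
    exact le_add_of_nonneg_left (sq_nonneg T)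
  have hfin3 : (2 * C₃ + 2 * C₄ * (3 + C₅)) * (A * (T ^ 2 + km ^ 2)) ≤ α * κ / 8 :=
    le_trans (by gcongr) hε1
  have hfin4 : α * κ ≤ α * (w (x, y, t) - w (x', y', s)) := by gcongr
  linarith

/-! ### Part 7: conclusion -/

lemma osc_y {n : ℕ} {G : Ham n} {l C₁ C₂ C₃ C₄ C₅ : ℝ} (h1 : HypH1 G) (h2 : HypH2 G C₁ C₂)
    (h3 : HypH3 G l C₃ C₄ C₅) {α : ℝ} (hα : 0 < α) {w : Dom n → ℝ} (hp : STPeriodic w)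
    (hs : ViscSol G α 0 w) (x : Euc n) (y y' t : ℝ) : w (x, y, t) - w (x, y', t) ≤ |l| := by
  obtain ⟨σ, hσ, hl⟩ : ∃ σ : ℝ, |σ| = 1 ∧ l = σ * |l| := by
    rcases le_total 0 l with h | h
    · exact ⟨1, by simp, by rw [abs_of_nonneg h, one_mul]⟩
    · exact ⟨-1, by simp, by rw [abs_of_nonpos h]; ring⟩
  have hσ2 : σ * σ = 1 := by rw [← abs_mul_abs_self, hσ]; norm_num
  obtain ⟨j, hj⟩ : ∃ j : ℤ, y + σ * Int.fract (σ * (y' - y)) = y' + j := by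
    rcases (abs_eq (zero_le_one' ℝ)).1 hσ with h | h
    · refine ⟨-⌊σ * (y' - y)⌋, ?_⟩
      rw [Int.fract, h]; push_cast; ring
    · refine ⟨⌊σ * (y' - y)⌋, ?_⟩
      rw [Int.fract, h]; ring
  have hm := mono_y h1 h2 h3 hα hp hs hσ hl (Int.fract_nonneg (σ * (y' - y))) x y t
  have hf1 := (Int.fract_lt_one (σ * (y' - y))).le
  have e : w (x, y' + j, t) = w (x, y', t) := by
    have := per_shift hp (fun _ => 0) j 0 x y' t
    have z0 : (intVec (fun _ => 0) : Euc n) = 0 := by ext i; simp [intVec]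
    simpa [z0] using this
  rw [hj, e] at hm
  exact hm.trans (mul_le_of_le_one_right (abs_nonneg l) hf1)

lemma low_bound {n : ℕ} {G : Ham n} {C₀ α : ℝ} (hG : ∀ x y t, |G x y t 0 0| ≤ C₀)
    (hα : 0 < α) {w : Dom n → ℝ} (hp : STPeriodic w) (hs : ViscSol G α 0 w) (z : Dom n) :
    -C₀ ≤ α * w z := by
  have hp' : STPeriodic (fun z => -w z) :=
    ⟨fun k x y t => congrArg Neg.neg (hp.1 k x y t), fun x y t => congrArg Neg.neg (hp.2.1 x y t),
      fun x y t => congrArg Neg.neg (hp.2.2 x y t)⟩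
  obtain ⟨m, hm⟩ := per_max hp' hs.1.neg
  have hv := hs.2.2.2 (fun _ => 0) contDiff_const m (Eventually.of_forall fun z => by
    have := hm z
    simp only
    linarith)
  have e1 : pdT (fun _ : Dom n => (0 : ℝ)) m = 0 := by simp [pdT]
  have e2 : pdY (fun _ : Dom n => (0 : ℝ)) m = 0 := by simp [pdY]
  have e3 : pdX (fun _ : Dom n => (0 : ℝ)) m = 0 := by ext i; simp [pdX]
  rw [e1, e2, e3] at hv
  have a := (abs_le.1 (hG m.1 m.2.1 m.2.2)).2
  have b : α * w m ≤ α * w z := by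
    have := hm z
    gcongr; linarith
  linarith

/-- Under (H1)–(H3), with C₀ an upper bound for |G(x,y,t,0,0)|,
there is a constant K depending only on n, C₀, C₁, C₂ and l such that the
oscillation of any continuous space-time periodic viscosity solution of
`w_t + G(x,y,t,D_x w,D_y w) + α w = 0` (α > 0) is at most K. -/
theorem statement1 {n : ℕ} (hn : 0 < n) (C₀ C₁ C₂ l : ℝ) (hC₁ : 0 < C₁) (hC₂ : 0 < C₂) :
    ∃ K : ℝ, ∀ (G : Ham n) (C₃ C₄ C₅ : ℝ),
      HypH1 G → HypH2 G C₁ C₂ → HypH3 G l C₃ C₄ C₅ →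
      (∀ x y t, |G x y t 0 0| ≤ C₀) →
      ∀ α : ℝ, 0 < α → ∀ w : Dom n → ℝ, STPeriodic w → ViscSol G α 0 w →
        ∀ z z' : Dom n, w z - w z' ≤ K := by
  refine ⟨|l| + 1 + (C₂ + |C₀| + 1) * (⌈((n : ℝ) + 1) / C₁⌉ + 1), ?_⟩
  intro G C₃ C₄ C₅ h1 h2 h3 hG α hα w hp hs z z'
  have hC₀ : 0 ≤ C₀ := (abs_nonneg _).trans (hG 0 0 0)
  rw [abs_of_nonneg hC₀]
  obtain ⟨x, y, t⟩ := z
  obtain ⟨x', y', t'⟩ := z'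
  obtain ⟨k, -, -, hk, -, -⟩ := per_red (x - x') 0 0
  obtain ⟨N, hN⟩ : ∃ N : ℤ, N = ⌈((n : ℝ) + 1) / C₁⌉ := ⟨_, rfl⟩
  rw [← hN]
  have hN1 : ((n : ℝ) + 1) / C₁ ≤ N := by rw [hN]; exact Int.le_ceil _
  have hN0 : (0 : ℝ) ≤ N := le_trans (by positivity) hN1
  rw [div_le_iff₀ hC₁] at hN1
  have e := per_shift hp k 0 (N - ⌊t - t'⌋) x y t
  have hd : t + ((N - ⌊t - t'⌋ : ℤ) : ℝ) - t' = N + Int.fract (t - t') := by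
    rw [Int.fract]; push_cast; ring
  have hf0 := Int.fract_nonneg (t - t')
  have hf1 := (Int.fract_lt_one (t - t')).le
  have key := eik h2 hC₀ hp hs.1 hs.2.1 (low_bound hG hα hp hs) (x₀ := x') (t₀ := t')
    (S := w (x', y', t') + |l|) (fun Y => by linarith [osc_y h1 h2 h3 hα hp hs x' Y y' t'])
    (x₁ := x + intVec k) (y₁ := y + ((0 : ℤ) : ℝ)) (t₁ := t + ((N - ⌊t - t'⌋ : ℤ) : ℝ))
    (by linarith) (by
      rw [hd, show x + intVec k - x' = x - x' + intVec k by abel]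
      refine hk.trans ?_
      have : C₁ * N ≤ C₁ * (N + Int.fract (t - t')) := by gcongr; linarith
      linarith)
  rw [e, hd] at key
  have : (C₂ + C₀ + 1) * (N + Int.fract (t - t')) ≤ (C₂ + C₀ + 1) * (N + 1) := by gcongr
  linarith
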